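/- (Extension estimates for the lifted operator.) In the original and lifted settings, let k ≥ 0 be an integer, let [a_{ij}] satisfy the ellipticity condition with constant Λ ∈ (0,1) with a_{ij} ∈ C^{k,α}_X(ℝ^n) for all 1 ≤ i,j ≤ m, set 𝓛 := ∑_{i,j=1}^m a_{ij}(x) X_iX_j, ã_{ij} := E(a_{ij}) and 𝓛̃ := ∑_{i,j=1}^m ã_{ij}(x,ξ) X̃_iX̃_j. Then for every u ∈ C^{k+2,α}_X(ℝ^n), the extension ũ := Eu (where (Eu)(x,ξ) := u(x)) satisfies: ũ ∈ C^{k+2,α}_{X̃}(ℝ^N); ‖u‖_{C^{k+2,α}_X(ℝ^n)} ≤ c · ‖ũ‖_{C^{k+2,α}_{X̃}(ℝ^N)}, where c is a constant independent of u; and ‖𝓛̃ũ‖_{C^{k,α}_{X̃}(ℝ^N)} ≤ ‖𝓛u‖_{C^{k,α}_X(ℝ^n)}. -/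

import Mathlib

open MeasureTheory

noncomputable section

variable {E : Type*} [NormedAddCommGroup E] [NormedSpace ℝ E]

/-- Derivative of `u` along the vector field `Y` at `x`. -/
def vfDeriv (Y : E → E) (u : E → ℝ) (x : E) : ℝ := lineDeriv ℝ u x (Y x)

/-- Iterated derivative along a list of vector fields. -/
def vfIter {m : ℕ} (Y : Fin m → E → E) : List (Fin m) → (E → ℝ) → E → ℝ
  | [], u => u
  | i :: l, u => vfDeriv (Y i) (vfIter Y l u)

/-- Lie bracket of two vector fields. -/
def vfLie (Y Z : E → E) (x : E) : E := fderiv ℝ Z x (Y x) - fderiv ℝ Y x (Z x)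

/-- Iterated Lie bracket along a nonempty list of indices. -/
def vfIterLie {m : ℕ} (Y : Fin m → E → E) : List (Fin m) → E → E
  | [] => fun _ => 0
  | [i] => Y i
  | i :: j :: l => vfLie (Y i) (vfIterLie Y (j :: l))

/-- Hörmander's condition: the iterated Lie brackets span the space at every point. -/
def HormanderCond {m : ℕ} (Y : Fin m → E → E) : Prop :=
  ∀ x : E,
    Submodule.span ℝ {v : E | ∃ l : List (Fin m), l ≠ [] ∧ v = vfIterLie Y l x} = ⊤

/-- Carnot–Carathéodory control distance induced by the vector fields `Y`. -/
def controlDist {m : ℕ} (Y : Fin m → E → E) (x y : E) : ℝ :=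
  sInf {δ : ℝ | 0 < δ ∧ ∃ γ : ℝ → E, ∃ c : Fin m → ℝ → ℝ, ∃ K : NNReal,
    LipschitzOnWith K γ (Set.Icc 0 1) ∧ γ 0 = x ∧ γ 1 = y ∧
    (∀ᵐ t ∂(volume.restrict (Set.Ioo (0:ℝ) 1)),
      HasDerivAt γ (∑ i, c i t • Y i (γ t)) t) ∧
    (∀ i, ∀ t ∈ Set.Icc (0:ℝ) 1, |c i t| < δ)}

def supBoundOn (Ω : Set E) (u : E → ℝ) (C : ℝ) : Prop := ∀ x ∈ Ω, |u x| ≤ C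

/-- Sup norm of `u` on `Ω`. -/
def supNormOn (Ω : Set E) (u : E → ℝ) : ℝ := sInf {C : ℝ | 0 ≤ C ∧ supBoundOn Ω u C}

def holderBoundOn (d : E → E → ℝ) (α : ℝ) (Ω : Set E) (u : E → ℝ) (C : ℝ) : Prop :=
  ∀ x ∈ Ω, ∀ y ∈ Ω, |u x - u y| ≤ C * d x y ^ α

/-- Hölder seminorm of `u` on `Ω` w.r.t. the distance `d`. -/
def holderSemi (d : E → E → ℝ) (α : ℝ) (Ω : Set E) (u : E → ℝ) : ℝ :=
  sInf {C : ℝ | 0 ≤ C ∧ holderBoundOn d α Ω u C}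

/-- Hölder norm of `u` on `Ω`. -/
def holderNorm (d : E → E → ℝ) (α : ℝ) (Ω : Set E) (u : E → ℝ) : ℝ :=
  supNormOn Ω u + holderSemi d α Ω u

/-- `u ∈ C^α(Ω)`: `u` is bounded and Hölder continuous on `Ω`. -/
def MemCalpha (d : E → E → ℝ) (α : ℝ) (Ω : Set E) (u : E → ℝ) : Prop :=
  (∃ C, 0 ≤ C ∧ supBoundOn Ω u C) ∧ ∃ C, 0 ≤ C ∧ holderBoundOn d α Ω u C

/-- `u ∈ C^{k,α}(Ω)`: all derivatives along the fields `Y` up to order `k`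
exist pointwise on `Ω` and belong to `C^α(Ω)`. -/
def MemCkAlpha {m : ℕ} (Y : Fin m → E → E) (d : E → E → ℝ) (α : ℝ) (k : ℕ)
    (Ω : Set E) (u : E → ℝ) : Prop :=
  (∀ l : List (Fin m), l.length ≤ k → MemCalpha d α Ω (vfIter Y l u)) ∧
  ∀ l : List (Fin m), l.length < k → ∀ i : Fin m, ∀ x ∈ Ω,
    LineDifferentiableAt ℝ (vfIter Y l u) x (Y i x)

/-- The `C^{k,α}(Ω)` norm: sum of the `C^α` norms of all derivatives up to order `k`. -/
def ckNorm {m : ℕ} (Y : Fin m → E → E) (d : E → E → ℝ) (α : ℝ) (k : ℕ)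
    (Ω : Set E) (u : E → ℝ) : ℝ :=
  ∑ j ∈ Finset.range (k + 1), ∑ f : Fin j → Fin m,
    holderNorm d α Ω (vfIter Y (List.ofFn f) u)

/-- Symmetric, uniformly positive-definite coefficient matrix with ellipticity constant `Λ`. -/
def EllipticSym {m : ℕ} (a : Fin m → Fin m → E → ℝ) (Λ : ℝ) : Prop :=
  ∀ x : E, (∀ i j, a i j x = a j i x) ∧
    ∀ ξ : Fin m → ℝ,
      Λ * (∑ i, ξ i ^ 2) ≤ (∑ i, ∑ j, a i j x * ξ i * ξ j) ∧
      (∑ i, ∑ j, a i j x * ξ i * ξ j) ≤ Λ⁻¹ * (∑ i, ξ i ^ 2)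

/-- The operator `L u = ∑_{i,j} a_{ij}(x) Y_i Y_j u`. -/
def opL {m : ℕ} (Y : Fin m → E → E) (a : Fin m → Fin m → E → ℝ) (u : E → ℝ) (x : E) : ℝ :=
  ∑ i, ∑ j, a i j x * vfIter Y [i, j] u x

/-- The frozen operator `L_{x̄} u = ∑_{i,j} a_{ij}(x̄) Y_i Y_j u`. -/
def opLFrozen {m : ℕ} (Y : Fin m → E → E) (a : Fin m → Fin m → E → ℝ) (xb : E)
    (u : E → ℝ) (x : E) : ℝ :=
  ∑ i, ∑ j, a i j xb * vfIter Y [i, j] u x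

/-- Anisotropic dilations `D_λ(x)_i = λ^{σ_i} x_i`. -/
def dil {N : ℕ} (σ : Fin N → ℕ) (l : ℝ) (x : Fin N → ℝ) : Fin N → ℝ :=
  fun i => l ^ (σ i) * x i

/-- A vector field `Y` is homogeneous of degree `s` with respect to the dilations `dil σ`. -/
def IsHomogeneousVF {N : ℕ} (σ : Fin N → ℕ) (Y : (Fin N → ℝ) → (Fin N → ℝ)) (s : ℝ) : Prop :=
  ∀ u : (Fin N → ℝ) → ℝ, ContDiff ℝ (⊤ : ℕ∞) u → ∀ l : ℝ, 0 < l → ∀ x,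
    vfDeriv Y (fun w => u (dil σ l w)) x = l ^ s * vfDeriv Y u (dil σ l x)

/-- Smooth homogeneous norm `‖x‖ = (∑ |x_i|^{2σ_N!/σ_i})^{1/(2σ_N!)}`. -/
def homNorm {N : ℕ} (σ : Fin N → ℕ) (x : Fin N → ℝ) : ℝ :=
  (∑ i, |x i| ^ ((2 * Nat.factorial (Finset.univ.sup σ)) / σ i)) ^
    ((1 : ℝ) / (2 * (Nat.factorial (Finset.univ.sup σ) : ℝ)))

/-- Left-invariance of a vector field with respect to the group operation `mul`. -/
def LeftInvariantVF (mul : E → E → E) (Y : E → E) : Prop :=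
  ∀ z : E, ∀ u : E → ℝ, ContDiff ℝ (⊤ : ℕ∞) u → ∀ x,
    vfDeriv Y (fun w => u (mul z w)) x = vfDeriv Y u (mul z x)

/-- The original homogeneous setting together with its global lifting to a Carnot
group on `ℝ^N = ℝ^n × ℝ^p`. -/
structure LiftedSetting (n p m : ℕ) where
  σ : Fin n → ℕ
  τ : Fin p → ℕ
  X : Fin m → (Fin n → ℝ) → (Fin n → ℝ)
  R : Fin m → ((Fin n → ℝ) × (Fin p → ℝ)) → (Fin p → ℝ)
  mul : ((Fin n → ℝ) × (Fin p → ℝ)) → ((Fin n → ℝ) × (Fin p → ℝ)) →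
    (Fin n → ℝ) × (Fin p → ℝ)
  inv : ((Fin n → ℝ) × (Fin p → ℝ)) → (Fin n → ℝ) × (Fin p → ℝ)
  σ_mono : Monotone σ
  σ_ge_one : ∀ i, 1 ≤ σ i
  σ_first : ∀ h : 0 < n, σ ⟨0, h⟩ = 1
  τ_ge_one : ∀ j, 1 ≤ τ j
  X_smooth : ∀ i, ContDiff ℝ (⊤ : ℕ∞) (X i)
  X_indep : LinearIndependent ℝ X
  X_homog : ∀ i, IsHomogeneousVF σ (X i) 1
  hormanderX : HormanderCond X
  q_gt_two : 2 < ∑ i, σ i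
  smooth_mul : ContDiff ℝ (⊤ : ℕ∞)
    (fun q : ((Fin n → ℝ) × (Fin p → ℝ)) × ((Fin n → ℝ) × (Fin p → ℝ)) => mul q.1 q.2)
  smooth_inv : ContDiff ℝ (⊤ : ℕ∞) inv
  mul_assoc' : ∀ x y z, mul (mul x y) z = mul x (mul y z)
  zero_mul' : ∀ x, mul 0 x = x
  mul_zero' : ∀ x, mul x 0 = x
  inv_mul' : ∀ x, mul (inv x) x = 0
  mul_inv' : ∀ x, mul x (inv x) = 0
  dil_auto : ∀ l : ℝ, 0 < l → ∀ x y : (Fin n → ℝ) × (Fin p → ℝ),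
    mul (dil σ l x.1, dil τ l x.2) (dil σ l y.1, dil τ l y.2)
      = (dil σ l (mul x y).1, dil τ l (mul x y).2)
  lift_smooth : ∀ i, ContDiff ℝ (⊤ : ℕ∞)
    (fun q : (Fin n → ℝ) × (Fin p → ℝ) => ((X i q.1, R i q) : (Fin n → ℝ) × (Fin p → ℝ)))
  lift_leftinv : ∀ i, LeftInvariantVF mul (fun q => (X i q.1, R i q))
  lift_homog : ∀ i, ∀ u : ((Fin n → ℝ) × (Fin p → ℝ)) → ℝ, ContDiff ℝ (⊤ : ℕ∞) u →
    ∀ l : ℝ, 0 < l → ∀ q : (Fin n → ℝ) × (Fin p → ℝ),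
      vfDeriv (fun q' => ((X i q'.1, R i q') : (Fin n → ℝ) × (Fin p → ℝ)))
          (fun w => u (dil σ l w.1, dil τ l w.2)) q
        = l * vfDeriv (fun q' => ((X i q'.1, R i q') : (Fin n → ℝ) × (Fin p → ℝ)))
            u (dil σ l q.1, dil τ l q.2)
  hormanderLift : HormanderCond
    (fun i (q : (Fin n → ℝ) × (Fin p → ℝ)) => ((X i q.1, R i q) : (Fin n → ℝ) × (Fin p → ℝ)))

namespace LiftedSetting

variable {n p m : ℕ}

/-- The lifted vector fields `X̃_i`. -/
def Xt (S : LiftedSetting n p m) :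
    Fin m → ((Fin n → ℝ) × (Fin p → ℝ)) → (Fin n → ℝ) × (Fin p → ℝ) :=
  fun i q => (S.X i q.1, S.R i q)

/-- Control distance on `ℝ^n`. -/
def dX (S : LiftedSetting n p m) : (Fin n → ℝ) → (Fin n → ℝ) → ℝ := controlDist S.X

/-- Control distance on the lifted space. -/
def dXt (S : LiftedSetting n p m) :
    ((Fin n → ℝ) × (Fin p → ℝ)) → ((Fin n → ℝ) × (Fin p → ℝ)) → ℝ := controlDist S.Xt

end LiftedSetting


open Filter Topology in
/-- There is an admissible curve from `x` to `y`. -/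
def Reach {m : ℕ} (Y : Fin m → E → E) (x y : E) : Prop :=
  {δ : ℝ | 0 < δ ∧ ∃ γ : ℝ → E, ∃ c : Fin m → ℝ → ℝ, ∃ K : NNReal,
    LipschitzOnWith K γ (Set.Icc 0 1) ∧ γ 0 = x ∧ γ 1 = y ∧
    (∀ᵐ t ∂(volume.restrict (Set.Ioo (0:ℝ) 1)),
      HasDerivAt γ (∑ i, c i t • Y i (γ t)) t) ∧
    (∀ i, ∀ t ∈ Set.Icc (0:ℝ) 1, |c i t| < δ)}.Nonempty

theorem Reach.refl {m : ℕ} (Y : Fin m → E → E) (x : E) : Reach Y x x := by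
  refine ⟨1, one_pos, fun _ => x, fun _ _ => 0, 0, ?_, rfl, rfl, ?_, ?_⟩
  · exact (LipschitzWith.const x).lipschitzOnWith
  · refine Filter.Eventually.of_forall fun t => ?_
    simpa using hasDerivAt_const t x
  · intro i t _; simp

theorem Reach.trans {m : ℕ} {Y : Fin m → E → E} {x y z : E}
    (h1 : Reach Y x y) (h2 : Reach Y y z) : Reach Y x z := by
  obtain ⟨δ1, hδ1, γ1, c1, K1, hL1, h10, h11, hd1, hc1⟩ := h1
  obtain ⟨δ2, hδ2, γ2, c2, K2, hL2, h20, h21, hd2, hc2⟩ := h2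
  let γ : ℝ → E := fun t => γ1 (min (2*t) 1) + (γ2 (max (2*t-1) 0) - y)
  have e1 : ∀ t, t ≤ 1/2 → γ t = γ1 (2*t) := by
    intro t ht
    have : max (2*t-1) 0 = 0 := max_eq_right (by linarith)
    have h' : min (2*t) 1 = 2*t := min_eq_left (by linarith)
    simp only [γ, this, h', h20]; simp
  have e2 : ∀ t, 1/2 ≤ t → γ t = γ2 (2*t-1) := by
    intro t ht
    have : max (2*t-1) 0 = 2*t-1 := max_eq_left (by linarith)
    have h' : min (2*t) 1 = 1 := min_eq_right (by linarith)
    simp only [γ, this, h', h11]; simp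
  have hmul : LipschitzWith 2 (fun t : ℝ => 2*t) := by
    refine LipschitzWith.of_dist_le_mul fun a b => ?_
    rw [Real.dist_eq, Real.dist_eq, ← mul_sub, abs_mul]; simp
  have hA : LipschitzWith 2 (fun t : ℝ => min (2*t) 1) := by
    simpa using hmul.min_const 1
  have hB : LipschitzWith 2 (fun t : ℝ => max (2*t-1) 0) := by
    have : LipschitzWith 2 (fun t : ℝ => 2*t-1) := by
      refine LipschitzWith.of_dist_le_mul fun a b => ?_
      have := hmul.dist_le_mul a b
      simpa using this
    simpa using this.max_const 0
  refine ⟨2 * δ1 + 2 * δ2, by positivity, γ,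
    fun i t => if t < 1/2 then 2 * c1 i (2*t) else 2 * c2 i (2*t-1),
    K1*2 + K2*2, ?_, ?_, ?_, ?_, ?_⟩
  · have a1 := hL1.comp (hA.lipschitzOnWith (s := Set.Icc 0 1)) (by
      intro t ht; constructor
      · exact le_min (by linarith [ht.1]) zero_le_one
      · exact min_le_right _ _)
    have a2 := hL2.comp (hB.lipschitzOnWith (s := Set.Icc 0 1)) (by
      intro t ht; constructor
      · exact le_max_right _ _
      · exact max_le (by linarith [ht.2]) zero_le_one)
    have a3 := a1.add (a2.add (LipschitzWith.const (-y)).lipschitzOnWith)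
    simp only [add_zero] at a3
    intro s hs t ht
    have := a3 hs ht
    simpa [γ, sub_eq_add_neg] using this
  · rw [e1 0 (by norm_num)]; simpa using h10
  · rw [e2 1 (by norm_num)]; norm_num; exact h21
  · rw [ae_restrict_iff' measurableSet_Ioo] at hd1 hd2 ⊢
    have q1 : MeasureTheory.Measure.QuasiMeasurePreserving (fun t : ℝ => 2*t) volume volume :=
      ⟨by fun_prop, by
        rw [Real.map_volume_mul_left (by norm_num)]
        exact Measure.smul_absolutelyContinuous⟩
    have q2 : MeasureTheory.Measure.QuasiMeasurePreserving (fun t : ℝ => 2*t-1) volume volume :=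
      (MeasureTheory.measurePreserving_sub_right volume (1:ℝ)).quasiMeasurePreserving.comp q1
    have hne : ∀ᵐ t : ℝ, t ≠ 1/2 := by simp [ae_iff, measure_singleton]
    filter_upwards [q1.ae hd1, q2.ae hd2, hne] with t k1 k2 hn ht
    rcases lt_or_gt_of_ne hn with hlt | hgt
    · have d := (k1 ⟨by linarith [ht.1], by linarith⟩).scomp t ((hasDerivAt_id t).const_mul 2)
      simp only [if_pos hlt, e1 t hlt.le]
      have d2 := d.congr_of_eventuallyEq (f₁ := γ) (by
        filter_upwards [Iio_mem_nhds hlt] with s hs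
        exact e1 s (le_of_lt hs))
      convert d2 using 1
      simp [Finset.smul_sum, smul_smul]
    · have d := (k2 ⟨by linarith, by linarith [ht.2]⟩).scomp t
        (((hasDerivAt_id t).const_mul 2).sub_const 1)
      simp only [if_neg (not_lt.2 hgt.le), e2 t hgt.le]
      have d2 := d.congr_of_eventuallyEq (f₁ := γ) (by
        filter_upwards [Ioi_mem_nhds hgt] with s hs
        exact e2 s (le_of_lt hs))
      convert d2 using 1
      simp [Finset.smul_sum, smul_smul]
  · intro i t ht
    by_cases h : t < 1/2
    · have := hc1 i (2*t) ⟨by linarith [ht.1], by linarith⟩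
      simp only [if_pos h, abs_mul, abs_two]; linarith
    · have := hc2 i (2*t-1) ⟨by linarith, by linarith [ht.2]⟩
      simp only [if_neg h, abs_mul, abs_two]; linarith

theorem reach_of_C1 {m : ℕ} {Y : Fin m → E → E} (i : Fin m) (hY : Continuous (Y i)) (a : ℝ)
    (γ : ℝ → E) (hγ : ∀ t ∈ Set.Icc (0:ℝ) 1, HasDerivAt γ (a • Y i (γ t)) t) :
    Reach Y (γ 0) (γ 1) := by
  classical
  have hcont : ContinuousOn (fun t => a • Y i (γ t)) (Set.Icc 0 1) := by
    have : ContinuousOn γ (Set.Icc 0 1) := fun t ht => (hγ t ht).continuousAt.continuousWithinAt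
    exact (hY.comp_continuousOn this).const_smul a
  obtain ⟨C, hC⟩ := isCompact_Icc.exists_bound_of_continuousOn hcont
  refine ⟨|a| + 1, by positivity, γ, fun j _ => if j = i then a else 0, C.toNNReal,
    ?_, rfl, rfl, ?_, ?_⟩
  · refine (convex_Icc (0:ℝ) 1).lipschitzOnWith_of_nnnorm_hasDerivWithin_le
      (fun t ht => (hγ t ht).hasDerivWithinAt) ?_
    intro t ht
    rw [← NNReal.coe_le_coe]
    exact (hC t ht).trans (Real.le_coe_toNNReal C)
  · rw [ae_restrict_iff' measurableSet_Ioo]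
    refine Filter.Eventually.of_forall fun t ht => ?_
    have := hγ t (Set.Ioo_subset_Icc_self ht)
    simpa [ite_smul] using this
  · intro j t _
    dsimp only
    split_ifs
    · linarith
    · simp; positivity

theorem two_le_smooth : minSmoothness ℝ 2 ≤ ((⊤ : ℕ∞) : WithTop ℕ∞) := by
  rw [minSmoothness_of_isRCLikeNormedField]
  have h : ((2 : ℕ∞) : WithTop ℕ∞) ≤ ((⊤ : ℕ∞) : WithTop ℕ∞) := WithTop.coe_le_coe.2 le_top
  exact h

/-- Group-like data used for the connectivity theorem. -/
structure GrpData (E : Type*) [NormedAddCommGroup E] [NormedSpace ℝ E] where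
  mul : E → E → E
  inv : E → E
  sm : ContDiff ℝ (⊤ : ℕ∞) (fun q : E × E => mul q.1 q.2)
  si : ContDiff ℝ (⊤ : ℕ∞) inv
  assoc : ∀ x y z, mul (mul x y) z = mul x (mul y z)
  zero_mul : ∀ x, mul 0 x = x
  mul_zero : ∀ x, mul x 0 = x
  inv_mul : ∀ x, mul (inv x) x = 0
  mul_inv : ∀ x, mul x (inv x) = 0

namespace GrpData

variable (G : GrpData E)

theorem inv_mul_cancel (a b : E) : G.mul (G.inv a) (G.mul a b) = b := by
  rw [← G.assoc, G.inv_mul, G.zero_mul]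
theorem mul_inv_cancel (a b : E) : G.mul a (G.mul (G.inv a) b) = b := by
  rw [← G.assoc, G.mul_inv, G.zero_mul]

theorem inv_unique {a b : E} (h : G.mul a b = 0) : G.inv a = b := by
  have := G.inv_mul_cancel a b
  rw [h, G.mul_zero] at this
  exact this

/-- Derivative of the multiplication. -/
def D (p : E × E) : E × E →L[ℝ] E := fderiv ℝ (fun q : E × E => G.mul q.1 q.2) p

theorem hasD (p : E × E) : HasFDerivAt (fun q : E × E => G.mul q.1 q.2) (G.D p) p :=
  (G.sm.differentiable (by simp)).differentiableAt.hasFDerivAt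

theorem hasStrictD (p : E × E) : HasStrictFDerivAt (fun q : E × E => G.mul q.1 q.2) (G.D p) p :=
  G.sm.contDiffAt.hasStrictFDerivAt (by simp)

theorem smD : ContDiff ℝ (⊤ : ℕ∞) G.D :=
  G.sm.fderiv_right (by simp)

theorem hasDL (z x : E) : HasFDerivAt (G.mul z)
    ((G.D (z, x)).comp (ContinuousLinearMap.inr ℝ E E)) x :=
  (G.hasD (z, x)).comp x (hasFDerivAt_prodMk_right z x)

theorem hasDR (z x : E) : HasFDerivAt (fun y => G.mul y z)
    ((G.D (x, z)).comp (ContinuousLinearMap.inl ℝ E E)) x :=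
  HasFDerivAt.comp (g := fun q : E × E => G.mul q.1 q.2) (f := fun e => (e, z)) x
    (G.hasD (x, z)) (hasFDerivAt_prodMk_left x z)

theorem D_zero_left (x v : E) : G.D (0, x) (0, v) = v := by
  have h := G.hasDL 0 x
  have : G.mul 0 = id := funext G.zero_mul
  rw [this] at h
  have := h.unique (hasFDerivAt_id x)
  simpa using congrArg (fun L => L v) this

theorem D_zero_right (x v : E) : G.D (x, 0) (v, 0) = v := by
  have h := G.hasDR 0 x
  have : (fun y => G.mul y 0) = id := funext G.mul_zero
  rw [this] at h
  have := h.unique (hasFDerivAt_id x)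
  simpa using congrArg (fun L => L v) this

/-- Left invariance. -/
def LI (Z : E → E) : Prop := ∀ z x, G.D (z, x) (0, Z x) = Z (G.mul z x)

theorem contL (z : E) : ContDiff ℝ (⊤ : ℕ∞) (G.mul z) :=
  G.sm.comp (contDiff_const.prodMk contDiff_id)

theorem LI_lie [CompleteSpace E] {V W : E → E} (hV : ContDiff ℝ (⊤ : ℕ∞) V)
    (hW : ContDiff ℝ (⊤ : ℕ∞) W)
    (lV : G.LI V) (lW : G.LI W) : G.LI (vfLie V W) := by
  intro z x
  have key := VectorField.fderiv_apply_lieBracket (𝕜 := ℝ) (f := G.mul z) (x := x) (V := V) (W := W)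
    (n := (⊤ : ℕ∞)) (G.contL z).contDiffAt two_le_smooth
    (hW.differentiable (by simp)).differentiableAt (hV.differentiable (by simp)).differentiableAt
  have aux : ∀ U : E → E, ContDiff ℝ (⊤ : ℕ∞) U → G.LI U → ∀ v,
      fderiv ℝ (fun x => fderiv ℝ (G.mul z) x (U x)) x v = fderiv ℝ U (G.mul z x) (G.D (z,x) (0,v)) := by
    intro U hU lU v
    have e : (fun x => fderiv ℝ (G.mul z) x (U x)) = fun x => U (G.mul z x) := by
      funext y
      rw [(G.hasDL z y).fderiv]
      exact lU z y
    rw [e]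
    have h1 := ((hU.differentiable (by simp)).differentiableAt (x := G.mul z x)).hasFDerivAt
    have := (h1.comp x (G.hasDL z x)).fderiv
    have h2 := congrArg (fun L => L v) this
    simpa [Function.comp_def] using h2
  rw [aux W hW lW, aux V hV lV, (G.hasDL z x).fderiv] at key
  rw [lV, lW] at key
  exact key

theorem LI_iter [CompleteSpace E] {m : ℕ} {Y : Fin m → E → E}
    (hY : ∀ i, ContDiff ℝ (⊤ : ℕ∞) (Y i))
    (lY : ∀ i, G.LI (Y i)) : ∀ l : List (Fin m), ContDiff ℝ (⊤ : ℕ∞) (vfIterLie Y l) ∧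
      G.LI (vfIterLie Y l)
  | [] => ⟨contDiff_const, fun z x => by
      have : ((0, 0) : E × E) = 0 := rfl
      simp [vfIterLie, this]⟩
  | [i] => ⟨hY i, lY i⟩
  | i :: j :: l => by
    have ih := LI_iter hY lY (j :: l)
    exact ⟨(hY i).lieBracket_vectorField ih.1 (by simp), G.LI_lie (hY i) ih.1 (lY i) ih.2⟩

/-- The transported vector. -/
def Wf (Z : E → E) (a : E) : E := G.D (a, G.inv a) (Z a, 0)

theorem D_Wf (Z : E → E) (a : E) : G.D (0, a) (G.Wf Z a, 0) = Z a := by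
  have h1 := G.hasDR (G.inv a) a
  have h2 := G.hasDR a (G.mul a (G.inv a))
  have h3 := h2.comp a h1
  have e : ((fun y => G.mul y a) ∘ fun y => G.mul y (G.inv a)) = id := by
    funext y
    simp [G.assoc, G.inv_mul, G.mul_zero]
  rw [e] at h3
  have := congrArg (fun L => L (Z a)) (h3.unique (hasFDerivAt_id a))
  simpa [G.mul_inv, Wf] using this

theorem Wf_smooth {Z : E → E} (hZ : ContDiff ℝ (⊤ : ℕ∞) Z) : ContDiff ℝ (⊤ : ℕ∞) (G.Wf Z) :=
  (G.smD.comp (contDiff_id.prodMk G.si)).clm_apply (hZ.prodMk contDiff_const)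

theorem Wf_deriv [CompleteSpace E] {Y Z : E → E} 
    (hZ : ContDiff ℝ (⊤ : ℕ∞) Z) (lY : G.LI Y) :
    fderiv ℝ (G.Wf Z) 0 (Y 0) = vfLie Y Z 0 := by
  have symm : ∀ v w, fderiv ℝ G.D (0,0) v w = fderiv ℝ G.D (0,0) w v := by
    have : IsSymmSndFDerivAt ℝ (fun q : E × E => G.mul q.1 q.2) (0,0) :=
      G.sm.contDiffAt.isSymmSndFDerivAt two_le_smooth
    intro v w
    exact this v w
  have hD : HasFDerivAt G.D (fderiv ℝ G.D (0,0)) (0,0) :=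
    (G.smD.differentiable (by simp)).differentiableAt.hasFDerivAt
  have hW : HasFDerivAt (G.Wf Z) (fderiv ℝ (G.Wf Z) 0) 0 :=
    ((G.Wf_smooth hZ).differentiable (by simp)).differentiableAt.hasFDerivAt
  have W0 : G.Wf Z 0 = Z 0 := by
    have := G.D_Wf Z 0
    rwa [G.D_zero_right] at this
  -- derivative of Z
  have hZ' : fderiv ℝ Z 0 (Y 0) = fderiv ℝ G.D (0,0) (0, Y 0) (Z 0, 0) + fderiv ℝ (G.Wf Z) 0 (Y 0) := by
    have a1 : HasFDerivAt (fun a => G.D ((0:E), a))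
      ((fderiv ℝ G.D (0,0)).comp (ContinuousLinearMap.inr ℝ E E)) 0 :=
      hD.comp (0:E) (hasFDerivAt_prodMk_right (0:E) (0:E))
    have a2 : HasFDerivAt (fun a => ((G.Wf Z a, 0) : E × E)) _ 0 := hW.prodMk (hasFDerivAt_const (0:E) (0:E))
    have a3 := a1.clm_apply a2
    have e : (fun y => (G.D ((0:E), y)) ((G.Wf Z y, 0) : E × E)) = Z := funext (G.D_Wf Z)
    rw [e] at a3
    rw [a3.fderiv]
    simp [W0, G.D_zero_right, add_comm]
  have hY' : fderiv ℝ Y 0 (Z 0) = fderiv ℝ G.D (0,0) (Z 0, 0) (0, Y 0) := by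
    have a1 : HasFDerivAt (fun a => G.D (a, (0:E)))
      ((fderiv ℝ G.D (0,0)).comp (ContinuousLinearMap.inl ℝ E E)) 0 :=
      HasFDerivAt.comp (g := G.D) (f := fun e => (e, (0:E))) (0:E) hD
        (hasFDerivAt_prodMk_left (0:E) (0:E))
    have a3 := a1.clm_apply (hasFDerivAt_const ((0, Y 0) : E × E) (0:E))
    have e : (fun y => (G.D (y, (0:E))) ((0, Y 0) : E × E)) = Y := by
      funext y
      rw [lY, G.mul_zero]
    rw [e] at a3
    rw [a3.fderiv]
    simp
  rw [vfLie, hZ', hY', symm (0, Y 0)]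
  abel

end GrpData

namespace GrpData

open Filter Topology

variable (G : GrpData E)

/-- Elements that are reachable by words in small flows. -/
inductive H {m : ℕ} (g : Fin m → ℝ → E) (ε : Fin m → ℝ) : E → Prop
  | zero : H g ε 0
  | fwd (z : E) (i : Fin m) (t : ℝ) (ht : |t| < ε i) (hz : H g ε z) : H g ε (G.mul z (g i t))
  | bwd (z : E) (i : Fin m) (t : ℝ) (ht : |t| < ε i) (hz : H g ε z) :
      H g ε (G.mul z (G.inv (g i t)))

variable {m : ℕ} {g : Fin m → ℝ → E} {ε : Fin m → ℝ}

theorem H.mul {G : GrpData E} {a b : E} (ha : G.H g ε a) (hb : G.H g ε b) :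
    G.H g ε (G.mul a b) := by
  induction hb with
  | zero => rwa [G.mul_zero]
  | fwd z i t ht _ ih => rw [← G.assoc]; exact H.fwd _ i t ht ih
  | bwd z i t ht _ ih => rw [← G.assoc]; exact H.bwd _ i t ht ih

theorem H.inv {G : GrpData E} {a : E} (ha : G.H g ε a) : G.H g ε (G.inv a) := by
  induction ha with
  | zero => 
    rw [G.inv_unique (G.zero_mul 0)]; exact H.zero
  | fwd z i t ht _ ih =>
    have : G.inv (G.mul z (g i t)) = G.mul (G.mul 0 (G.inv (g i t))) (G.inv z) := by
      apply G.inv_unique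
      rw [G.zero_mul, G.assoc, G.mul_inv_cancel, G.mul_inv]
    rw [this]
    exact (H.bwd 0 i t ht H.zero).mul ih
  | bwd z i t ht _ ih =>
    have : G.inv (G.mul z (G.inv (g i t))) = G.mul (G.mul 0 (g i t)) (G.inv z) := by
      apply G.inv_unique
      rw [G.zero_mul, G.assoc, G.inv_mul_cancel, G.mul_inv]
    rw [this]
    exact (H.fwd 0 i t ht H.zero).mul ih

theorem flow_curve {Y : Fin m → E → E} (lY : ∀ i, G.LI (Y i))
    (hg : ∀ i t, |t| < ε i → HasDerivAt (g i) (Y i (g i t)) t) (z : E) (i : Fin m) (t : ℝ)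
    (ht : |t| < ε i) : HasDerivAt (fun s => G.mul z (g i s)) (Y i (G.mul z (g i t))) t := by
  have := (G.hasDL z (g i t)).comp_hasDerivAt t (hg i t ht)
  rw [← lY]
  exact this

theorem H.reach {G : GrpData E} {Y : Fin m → E → E} (hY : ∀ i, Continuous (Y i))
    (lY : ∀ i, G.LI (Y i)) (g0 : ∀ i, g i 0 = 0)
    (hg : ∀ i t, |t| < ε i → HasDerivAt (g i) (Y i (g i t)) t) {a : E} (ha : G.H g ε a) (z : E) :
    Reach Y z (G.mul z a) := by
  have small : ∀ (i : Fin m) (t s : ℝ), |t| < ε i → s ∈ Set.Icc (0:ℝ) 1 → |t * s| < ε i := by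
    intro i t s ht hs
    rw [abs_mul, abs_of_nonneg hs.1]
    exact lt_of_le_of_lt (mul_le_of_le_one_right (abs_nonneg t) hs.2) ht
  induction ha with
  | zero => rw [G.mul_zero]; exact Reach.refl Y z
  | fwd a i t ht _ ih =>
    refine ih.trans ?_
    rw [← G.assoc]
    have := reach_of_C1 (Y := Y) i (hY i) t (fun s => G.mul (G.mul z a) (g i (t * s))) (by
      intro s hs
      have h1 := G.flow_curve lY hg (G.mul z a) i (t*s) (small i t s ht hs)
      have h2 := h1.scomp s ((hasDerivAt_id s).const_mul t)
      simpa [Function.comp_def] using h2)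
    simpa [g0, G.mul_zero] using this
  | bwd a i t ht _ ih =>
    refine ih.trans ?_
    rw [← G.assoc]
    have := reach_of_C1 (Y := Y) i (hY i) (-t)
      (fun s => G.mul (G.mul (G.mul z a) (G.inv (g i t))) (g i (t * (1 - s)))) (by
      intro s hs
      have h1 := G.flow_curve lY hg (G.mul (G.mul z a) (G.inv (g i t))) i (t*(1-s))
        (small i t (1-s) ht ⟨by linarith [hs.2], by linarith [hs.1]⟩)
      have h2 := h1.scomp s (((hasDerivAt_id s).const_sub 1).const_mul t)
      simpa [Function.comp_def] using h2)
    simpa [g0, G.mul_zero, G.assoc, G.inv_mul] using this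

/-- Tangent vectors at the identity of curves inside the reachable set. -/
def tan (G : GrpData E) (g : Fin m → ℝ → E) (ε : Fin m → ℝ) : Submodule ℝ E where
  carrier := {v | ∃ c : ℝ → E, HasStrictDerivAt c v 0 ∧ c 0 = 0 ∧ ∀ᶠ t in 𝓝 0, G.H g ε (c t)}
  zero_mem' := ⟨fun _ => 0, hasStrictDerivAt_const _ _, rfl, Eventually.of_forall fun _ => H.zero⟩
  add_mem' := by
    rintro v w ⟨c, hc, c0, hcH⟩ ⟨b, hb, b0, hbH⟩
    refine ⟨fun t => G.mul (c t) (b t), ?_, ?_, ?_⟩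
    · have h := (G.hasStrictD (c 0, b 0)).comp_hasStrictDerivAt (0:ℝ) (hc.prodMk hb)
      have e : G.D (c 0, b 0) (v, w) = v + w := by
        have : ((v, w) : E × E) = (v, 0) + (0, w) := by simp
        rw [this, map_add, c0, b0, G.D_zero_left, G.D_zero_right]
      rw [e] at h
      exact h
    · simp [c0, b0, G.mul_zero]
    · filter_upwards [hcH, hbH] with t h1 h2 using h1.mul h2
  smul_mem' := by
    rintro a v ⟨c, hc, c0, hcH⟩
    refine ⟨fun t => c (a * t), ?_, by simpa using c0, ?_⟩
    · have hc' : HasStrictDerivAt c v (a * 0) := by simpa using hc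
      have := hc'.scomp (0:ℝ) ((hasStrictDerivAt_id (0:ℝ)).const_mul a)
      simpa [Function.comp_def] using this
    · have : Tendsto (fun t : ℝ => a * t) (𝓝 0) (𝓝 0) := by
        have : Continuous (fun t : ℝ => a * t) := by fun_prop
        simpa using this.tendsto 0
      exact this.eventually hcH

theorem tan_conj {G : GrpData E} {Z : E → E} (lZ : G.LI Z) (hZ : Z 0 ∈ G.tan g ε) {a : E}
    (ha : G.H g ε a) : G.Wf Z a ∈ G.tan g ε := by
  obtain ⟨c, hc, c0, hcH⟩ := hZ
  refine ⟨fun t => G.mul (G.mul a (c t)) (G.inv a), ?_, ?_, ?_⟩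
  · have h1 := (G.hasStrictD (a, c 0)).comp_hasStrictDerivAt (0:ℝ)
      ((hasStrictDerivAt_const (0:ℝ) a).prodMk hc)
    have h2 := (G.hasStrictD (G.mul a (c 0), G.inv a)).comp_hasStrictDerivAt (0:ℝ)
      (h1.prodMk (hasStrictDerivAt_const (0:ℝ) (G.inv a)))
    have e := lZ a 0
    rw [G.mul_zero] at e
    simp only [c0, G.mul_zero, e] at h2
    exact h2
  · simp [c0, G.mul_zero, G.mul_inv]
  · filter_upwards [hcH] with t h using (ha.mul h).mul ha.inv

theorem mem_of_hasDerivAt {S : Submodule ℝ E} (hS : IsClosed (S : Set E)) {f : ℝ → E} {f' : E}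
    (hf : HasDerivAt f f' 0) (h : ∀ᶠ t in 𝓝 (0:ℝ), f t ∈ S) : f' ∈ S := by
  have ht := hasDerivAt_iff_tendsto_slope.1 hf
  refine hS.mem_of_tendsto ht ?_
  filter_upwards [h.filter_mono nhdsWithin_le_nhds] with t ht
  exact S.smul_mem _ (S.sub_mem ht h.self_of_nhds)

theorem bracket_mem [FiniteDimensional ℝ E] {G : GrpData E} {Y : Fin m → E → E}
    (hY : ∀ i, ContDiff ℝ (⊤ : ℕ∞) (Y i))
    (lY : ∀ i, G.LI (Y i)) (g0 : ∀ i, g i 0 = 0) (εpos : ∀ i, 0 < ε i)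
    (hg : ∀ i t, |t| < ε i → HasDerivAt (g i) (Y i (g i t)) t) :
    ∀ l : List (Fin m), vfIterLie Y l 0 ∈ G.tan g ε := by
  have : CompleteSpace E := FiniteDimensional.complete ℝ E
  have near : ∀ i, ∀ᶠ t in 𝓝 (0:ℝ), |t| < ε i := by
    intro i
    have : Continuous (fun t : ℝ => |t|) := continuous_abs
    exact (this.tendsto 0).eventually (gt_mem_nhds (by simpa using εpos i))
  have hH : ∀ i, ∀ᶠ t in 𝓝 (0:ℝ), G.H g ε (g i t) := by
    intro i
    filter_upwards [near i] with t ht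
    have := H.fwd (G := G) (g := g) (ε := ε) 0 i t ht H.zero
    rwa [G.zero_mul] at this
  have base : ∀ i, Y i 0 ∈ G.tan g ε := by
    intro i
    refine ⟨g i, ?_, g0 i, hH i⟩
    have hc : ContinuousAt (fun t => Y i (g i t)) 0 :=
      (hY i).continuous.continuousAt.comp (hg i 0 (by simpa using εpos i)).continuousAt
    have := hasStrictDerivAt_of_hasDerivAt_of_continuousAt
      ((near i).mono fun t ht => hg i t ht) hc
    simpa [g0] using this
  intro l
  induction l with
  | nil => exact Submodule.zero_mem _
  | cons i l ih =>
    cases l with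
    | nil => exact base i
    | cons j l =>
      have hZ := G.LI_iter hY lY (j :: l)
      have hW := ((G.Wf_smooth hZ.1).differentiable (by simp)).differentiableAt (x := g i 0)
      have hd := hW.hasFDerivAt.comp_hasDerivAt (0:ℝ) (hg i 0 (by simpa using εpos i))
      rw [g0, G.Wf_deriv hZ.1 (lY i)] at hd
      refine mem_of_hasDerivAt (Submodule.closed_of_finiteDimensional _) hd ?_
      filter_upwards [hH i] with t ht
      exact tan_conj hZ.2 ih ht

theorem nhds_H [FiniteDimensional ℝ E] {G : GrpData E} (ht : G.tan g ε = ⊤) :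
    ∀ᶠ z in 𝓝 (0:E), G.H g ε z := by
  classical
  have : CompleteSpace E := FiniteDimensional.complete ℝ E
  let b := Module.finBasis ℝ E
  have hb : ∀ i, b i ∈ G.tan g ε := fun i => by rw [ht]; trivial
  choose c hc c0 hcH using hb
  have key : ∀ s : Finset (Fin (Module.finrank ℝ E)),
      ∃ Φ : (Fin (Module.finrank ℝ E) → ℝ) → E,
      HasStrictFDerivAt Φ (∑ i ∈ s, (ContinuousLinearMap.proj (R := ℝ)
        (φ := fun _ : Fin (Module.finrank ℝ E) => ℝ) i).smulRight (b i)) 0 ∧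
      Φ 0 = 0 ∧ ∀ᶠ t in 𝓝 0, G.H g ε (Φ t) := by
    intro s
    induction s using Finset.induction_on with
    | empty =>
      refine ⟨fun _ => 0, ?_, rfl, Eventually.of_forall fun _ => H.zero⟩
      simpa using hasStrictFDerivAt_const (𝕜 := ℝ) (0:E) (0 : Fin (Module.finrank ℝ E) → ℝ)
    | insert i s hi ih =>
      obtain ⟨Φ, hΦ, Φ0, hΦH⟩ := ih
      have hp : HasStrictFDerivAt (fun t : Fin (Module.finrank ℝ E) → ℝ => t i)
        (ContinuousLinearMap.proj (R := ℝ)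
        (φ := fun _ : Fin (Module.finrank ℝ E) => ℝ) i) 0 :=
        (ContinuousLinearMap.proj (R := ℝ)
        (φ := fun _ : Fin (Module.finrank ℝ E) => ℝ) i).hasStrictFDerivAt
      have hci : HasStrictDerivAt (c i) (b i) ((0 : Fin (Module.finrank ℝ E) → ℝ) i) := hc i
      have h1 := hci.hasStrictFDerivAt.comp (0 : Fin (Module.finrank ℝ E) → ℝ) hp
      have h2 := (G.hasStrictD (Φ 0, c i ((0 : Fin (Module.finrank ℝ E) → ℝ) i))).comp
        (0 : Fin (Module.finrank ℝ E) → ℝ) (hΦ.prodMk h1)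
      refine ⟨fun t => G.mul (Φ t) (c i (t i)), ?_, ?_, ?_⟩
      · refine HasStrictFDerivAt.congr_fderiv h2 ?_
        rw [Finset.sum_insert hi]
        ext t
        simp only [Pi.zero_apply, c0, Φ0]
        have split : ∀ v w : E, G.D (0, 0) (v, w) = v + w := by
          intro v w
          have : ((v, w) : E × E) = (v, 0) + (0, w) := by simp
          rw [this, map_add, G.D_zero_left, G.D_zero_right]
        simp [split, add_comm]
      · simp [Φ0, c0, G.mul_zero]
      · have : Tendsto (fun t : Fin (Module.finrank ℝ E) → ℝ => t i) (𝓝 0) (𝓝 0) :=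
          (continuous_apply i).tendsto 0
        filter_upwards [hΦH, this.eventually (hcH i)] with t k1 k2 using k1.mul k2
  obtain ⟨Φ, hΦ, Φ0, hΦH⟩ := key Finset.univ
  have hm := hΦ.map_nhds_eq_of_surj (by
    rw [eq_top_iff]
    intro v _
    refine ⟨fun i => b.repr v i, ?_⟩
    simpa using b.sum_repr v)
  rw [Φ0] at hm
  rw [← hm]
  exact hΦH

theorem all_H {G : GrpData E} (hn : ∀ᶠ z in 𝓝 (0:E), G.H g ε z) (z : E) : G.H g ε z := by
  have hcm : Continuous (fun q : E × E => G.mul q.1 q.2) := G.sm.continuous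
  have hci : Continuous G.inv := G.si.continuous
  have ho : IsOpen {z | G.H g ε z} := by
    rw [isOpen_iff_mem_nhds]
    intro a ha
    have hc : Continuous (fun w => G.mul (G.inv a) w) := by fun_prop
    have := hc.tendsto a
    rw [G.inv_mul] at this
    filter_upwards [this.eventually hn] with w hw
    have := H.mul ha hw
    rwa [G.mul_inv_cancel] at this
  have hcl : IsClosed {z | G.H g ε z} := by
    rw [← isOpen_compl_iff, isOpen_iff_mem_nhds]
    intro a ha
    have hc : Continuous (fun w => G.mul (G.inv w) a) := by fun_prop
    have := hc.tendsto a
    rw [G.inv_mul] at this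
    filter_upwards [this.eventually hn] with w hw hw2
    have := H.mul hw2 hw
    rw [G.mul_inv_cancel] at this
    exact ha this
  have hu := IsClopen.eq_univ ⟨hcl, ho⟩ ⟨0, H.zero⟩
  have : z ∈ {z | G.H g ε z} := by rw [hu]; trivial
  exact this

theorem chow [FiniteDimensional ℝ E] (G : GrpData E) {Y : Fin m → E → E}
    (hY : ∀ i, ContDiff ℝ (⊤ : ℕ∞) (Y i))
    (lY : ∀ i, G.LI (Y i)) (hH : HormanderCond Y) (x y : E) : Reach Y x y := by
  have : CompleteSpace E := FiniteDimensional.complete ℝ E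
  have ex : ∀ i, ∃ α : ℝ → E, α 0 = 0 ∧ ∃ ε > (0 : ℝ),
      ∀ t ∈ Set.Ioo (0 - ε) (0 + ε), HasDerivAt α (Y i (α t)) t := fun i =>
    ContDiffAt.exists_forall_mem_closedBall_exists_eq_forall_mem_Ioo_hasDerivAt₀
      ((hY i).contDiffAt.of_le (by simp)) 0
  choose g g0 ε εpos hg using ex
  have hg' : ∀ i t, |t| < ε i → HasDerivAt (g i) (Y i (g i t)) t := by
    intro i t ht
    refine hg i t ?_
    rw [abs_lt] at ht
    constructor <;> linarith [ht.1, ht.2]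
  have top : G.tan g ε = ⊤ := by
    rw [eq_top_iff, ← hH 0, Submodule.span_le]
    rintro v ⟨l, _, rfl⟩
    exact bracket_mem hY lY g0 εpos hg' l
  have h := (all_H (nhds_H top) (G.mul (G.inv x) y)).reach (fun i => (hY i).continuous) lY g0 hg' x
  rwa [G.mul_inv_cancel] at h

end GrpData

section Lift

open Filter Topology Matrix

/-- Regularised least squares solution. -/
def lsq {n m : ℕ} (A : Matrix (Fin n) (Fin m) ℝ) (v : Fin n → ℝ) (k : ℕ) : Fin m → ℝ :=
  (Aᵀ * A + (1 / ((k:ℝ) + 1)) • (1 : Matrix (Fin m) (Fin m) ℝ))⁻¹ *ᵥ (Aᵀ *ᵥ v)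

theorem reg_bound {n m : ℕ} (A : Matrix (Fin n) (Fin m) ℝ) {e : ℝ} (he : 0 < e) (z : Fin m → ℝ) :
    e ^ 2 * (z ⬝ᵥ z) ≤ ((Aᵀ * A + e • (1 : Matrix (Fin m) (Fin m) ℝ)) *ᵥ z) ⬝ᵥ
      ((Aᵀ * A + e • (1 : Matrix (Fin m) (Fin m) ℝ)) *ᵥ z) := by
  have h1 : (Aᵀ * A + e • (1 : Matrix (Fin m) (Fin m) ℝ)) *ᵥ z = (Aᵀ * A) *ᵥ z + e • z := by
    rw [Matrix.add_mulVec, Matrix.smul_mulVec, Matrix.one_mulVec]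
  have h2 : ((Aᵀ * A) *ᵥ z) ⬝ᵥ z = (A *ᵥ z) ⬝ᵥ (A *ᵥ z) := by
    rw [← Matrix.mulVec_mulVec, Matrix.mulVec_transpose, ← Matrix.dotProduct_mulVec]
  have p1 : 0 ≤ (A *ᵥ z) ⬝ᵥ (A *ᵥ z) := Finset.sum_nonneg fun i _ => mul_self_nonneg _
  have p2 : 0 ≤ ((Aᵀ * A) *ᵥ z) ⬝ᵥ ((Aᵀ * A) *ᵥ z) := Finset.sum_nonneg fun i _ => mul_self_nonneg _
  rw [h1]
  simp only [add_dotProduct, dotProduct_add, smul_dotProduct, dotProduct_smul, smul_eq_mul]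
  rw [dotProduct_comm z ((Aᵀ * A) *ᵥ z), h2]
  nlinarith [mul_nonneg he.le p1]

theorem reg_isUnit {n m : ℕ} (A : Matrix (Fin n) (Fin m) ℝ) {e : ℝ} (he : 0 < e) :
    IsUnit (Aᵀ * A + e • (1 : Matrix (Fin m) (Fin m) ℝ)).det := by
  rw [isUnit_iff_ne_zero]
  intro h
  obtain ⟨v, hv, hv0⟩ := Matrix.exists_mulVec_eq_zero_iff.2 h
  have := reg_bound A he v
  rw [hv0] at this
  simp only [dotProduct_zero] at this
  have h3 : v ⬝ᵥ v ≤ 0 := by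
    by_contra hcon
    push Not at hcon
    have : 0 < e ^ 2 * (v ⬝ᵥ v) := by positivity
    linarith
  have h4 : v ⬝ᵥ v = 0 := le_antisymm h3 (Finset.sum_nonneg fun i _ => mul_self_nonneg _)
  exact hv (dotProduct_self_eq_zero.1 h4)

theorem exists_normal {n m : ℕ} (A : Matrix (Fin n) (Fin m) ℝ) (c : Fin m → ℝ) :
    ∃ w, (Aᵀ * A) *ᵥ ((Aᵀ * A) *ᵥ w) = (Aᵀ * A) *ᵥ c := by
  set B := Aᵀ * A with hB
  have hBt : Bᵀ = B := by simp [hB]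
  have hr : (B * B).rank = B.rank := by
    have := Matrix.rank_transpose_mul_self B
    rwa [hBt] at this
  have hle : LinearMap.range (B * B).mulVecLin ≤ LinearMap.range B.mulVecLin := by
    rw [Matrix.mulVecLin_mul]
    exact LinearMap.range_comp_le_range _ _
  have heq := Submodule.eq_of_le_of_finrank_eq hle hr
  have : B *ᵥ c ∈ LinearMap.range (B * B).mulVecLin := by
    rw [heq]; exact ⟨c, rfl⟩
  obtain ⟨w, hw⟩ := this
  refine ⟨w, ?_⟩
  rw [Matrix.mulVec_mulVec]
  exact hw

theorem lsq_limit {n m : ℕ} (A : Matrix (Fin n) (Fin m) ℝ) (c : Fin m → ℝ) :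
    ∃ c1 : Fin m → ℝ, Tendsto (fun k => lsq A (A *ᵥ c) k) atTop (𝓝 c1) ∧
      A *ᵥ c1 = A *ᵥ c ∧ c1 ⬝ᵥ c1 ≤ c ⬝ᵥ c := by
  obtain ⟨w, hw⟩ := exists_normal A c
  set B := Aᵀ * A with hB
  have hBt : Bᵀ = B := by simp [hB]
  refine ⟨B *ᵥ w, ?_, ?_, ?_⟩
  · rw [tendsto_pi_nhds]
    intro i
    have key : ∀ k : ℕ, |lsq A (A *ᵥ c) k i - (B *ᵥ w) i| ≤
        (1 / ((k:ℝ) + 1)) * (|w i| + √ (w ⬝ᵥ w)) := by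
      intro k
      set e : ℝ := 1 / ((k:ℝ) + 1) with he
      have hepos : 0 < e := by positivity
      have hu := reg_isUnit A hepos
      set M := Aᵀ * A + e • (1 : Matrix (Fin m) (Fin m) ℝ) with hM
      set z := M⁻¹ *ᵥ w with hz
      have hMz : M *ᵥ z = w := by
        rw [hz, Matrix.mulVec_mulVec, Matrix.mul_nonsing_inv _ hu, Matrix.one_mulVec]
      have hb := reg_bound A hepos z
      rw [← hM, hMz] at hb
      have hy : lsq A (A *ᵥ c) k = B *ᵥ w + (e ^ 2) • z - e • w := by
        have h1 : B *ᵥ c = M *ᵥ (B *ᵥ w + (e ^ 2) • z - e • w) := by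
          rw [Matrix.mulVec_sub, Matrix.mulVec_add, Matrix.mulVec_smul, Matrix.mulVec_smul, hMz]
          rw [hM, ← hB]
          simp only [Matrix.add_mulVec, Matrix.smul_mulVec, Matrix.one_mulVec, hw]
          ext j
          simp
          ring
        have h0 : Aᵀ *ᵥ (A *ᵥ c) = B *ᵥ c := by rw [Matrix.mulVec_mulVec]
        rw [lsq, h0, h1, Matrix.mulVec_mulVec]
        change (M⁻¹ * M) *ᵥ _ = _
        rw [Matrix.nonsing_inv_mul _ hu, Matrix.one_mulVec]
      have hzi : |e * z i| ≤ √ (w ⬝ᵥ w) := by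
        apply Real.abs_le_sqrt
        refine le_trans ?_ hb
        rw [mul_pow]
        have : z i ^ 2 ≤ z ⬝ᵥ z := by
          rw [sq]
          exact Finset.single_le_sum (f := fun j => z j * z j) (fun j _ => mul_self_nonneg _) (Finset.mem_univ i)
        exact mul_le_mul_of_nonneg_left this (by positivity)
      have h5 : lsq A (A *ᵥ c) k i - (B *ᵥ w) i = e * (e * z i - w i) := by
        rw [hy]; simp; ring
      rw [h5, abs_mul, abs_of_pos hepos]
      refine mul_le_mul_of_nonneg_left ?_ hepos.le
      have := abs_sub (e * z i) (w i)
      linarith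
    rw [tendsto_iff_dist_tendsto_zero]
    refine squeeze_zero (g := fun k : ℕ => 1 / ((k:ℝ) + 1) * (|w i| + √ (w ⬝ᵥ w)))
      (fun _ => dist_nonneg) (fun k => (Real.dist_eq _ _).trans_le (key k)) ?_
    have := tendsto_one_div_add_atTop_nhds_zero_nat (𝕜 := ℝ)
    simpa using this.mul_const (|w i| + √ (w ⬝ᵥ w))
  · have h0 : (Aᵀ * A) *ᵥ (B *ᵥ w - c) = 0 := by rw [Matrix.mulVec_sub, ← hB, hw, sub_self]
    have h1 : B *ᵥ w - c ∈ LinearMap.ker (Aᵀ * A).mulVecLin := h0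
    rw [Matrix.ker_mulVecLin_transpose_mul_self] at h1
    have h2 : A *ᵥ (B *ᵥ w - c) = 0 := h1
    rw [Matrix.mulVec_sub, sub_eq_zero] at h2
    exact h2
  · have h0 : B *ᵥ (c - B *ᵥ w) = 0 := by rw [Matrix.mulVec_sub, hw, sub_self]
    have h1 : (B *ᵥ w) ⬝ᵥ (c - B *ᵥ w) = 0 := by
      have sw : ∀ r, (B *ᵥ w) ⬝ᵥ r = w ⬝ᵥ (B *ᵥ r) := by
        intro r
        conv_lhs => rw [← hBt]
        rw [Matrix.mulVec_transpose, ← Matrix.dotProduct_mulVec]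
      rw [sw, h0, dotProduct_zero]
    set r := c - B *ᵥ w with hr
    have hc : c = B *ᵥ w + r := by rw [hr]; abel
    have hrr : 0 ≤ r ⬝ᵥ r := Finset.sum_nonneg fun i _ => mul_self_nonneg _
    have : c ⬝ᵥ c = (B *ᵥ w) ⬝ᵥ (B *ᵥ w) + r ⬝ᵥ r := by
      conv_lhs => rw [hc]
      simp only [add_dotProduct, dotProduct_add]
      rw [dotProduct_comm r, h1]; ring
    linarith

theorem measurable_lsq {n m : ℕ} {A : ℝ → Matrix (Fin n) (Fin m) ℝ} {v : ℝ → Fin n → ℝ}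
    (hA : ∀ i j, Measurable fun t => A t i j) (hv : ∀ i, Measurable fun t => v t i) (k : ℕ) :
    Measurable fun t => lsq (A t) (v t) k := by
  rw [measurable_pi_iff]
  intro i
  have hM : ∀ a b, Measurable fun t => ((A t)ᵀ * A t + (1 / ((k:ℝ) + 1)) • (1 : Matrix (Fin m) (Fin m) ℝ)) a b := by
    intro a b
    simp only [Matrix.add_apply, Matrix.mul_apply, Matrix.transpose_apply]
    refine Measurable.add ?_ measurable_const
    exact Finset.measurable_sum _ fun j _ => (hA j a).mul (hA j b)
  have hdet : ∀ (N : ℝ → Matrix (Fin m) (Fin m) ℝ), (∀ a b, Measurable fun t => N t a b) →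
      Measurable fun t => (N t).det := by
    intro N hN
    simp only [Matrix.det_apply]
    refine Finset.measurable_sum _ fun σ _ => ?_
    refine Measurable.const_smul ?_ _
    exact Finset.measurable_prod _ fun j _ => hN _ _
  simp only [lsq, Matrix.mulVec, dotProduct]
  refine Finset.measurable_sum _ fun j _ => Measurable.mul ?_ ?_
  · simp only [Matrix.inv_def, Matrix.smul_apply, Ring.inverse_eq_inv', smul_eq_mul]
    refine Measurable.mul ((hdet _ hM).inv) ?_
    simp only [Matrix.adjugate_apply]
    refine hdet _ ?_
    intro a b
    by_cases h : a = j
    · subst h; simp only [Matrix.updateRow_self]; exact measurable_const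
    · simp only [Matrix.updateRow_ne h]; exact hM a b
  · refine Finset.measurable_sum _ fun l _ => Measurable.mul (hA l j) (hv l)

/-- Measurable selection of controls. -/
theorem exists_measurable_controls {n m : ℕ} (X : Fin m → (Fin n → ℝ) → (Fin n → ℝ))
    (hX : ∀ i, Continuous (X i)) (γ : ℝ → Fin n → ℝ) (hγ : Continuous γ) (c : Fin m → ℝ → ℝ)
    {δ : ℝ} (hδ : 0 < δ)
    (hd : ∀ᵐ t ∂(volume.restrict (Set.Ioo (0:ℝ) 1)), HasDerivAt γ (∑ i, c i t • X i (γ t)) t)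
    (hc : ∀ i, ∀ t ∈ Set.Icc (0:ℝ) 1, |c i t| < δ) :
    ∃ b : Fin m → ℝ → ℝ, (∀ i, Measurable (b i)) ∧ (∀ i t, |b i t| < (m + 1) * δ) ∧
      ∀ᵐ t ∂(volume.restrict (Set.Ioo (0:ℝ) 1)), HasDerivAt γ (∑ i, b i t • X i (γ t)) t := by
  let A : ℝ → Matrix (Fin n) (Fin m) ℝ := fun t => Matrix.of fun k i => X i (γ t) k
  have hA : ∀ i j, Measurable fun t => A t i j := by
    intro i j
    exact ((continuous_apply i).comp ((hX j).comp hγ)).measurable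
  have hv : ∀ i, Measurable fun t => deriv γ t i := by
    intro i
    exact (measurable_pi_apply i).comp (measurable_deriv γ)
  have hsum : ∀ (x : Fin m → ℝ) t, A t *ᵥ x = ∑ i, x i • X i (γ t) := by
    intro x t
    ext k
    simp [A, Matrix.mulVec, dotProduct, Finset.sum_apply, mul_comm]
  have hd' : ∀ᵐ t ∂(volume.restrict (Set.Ioo (0:ℝ) 1)), t ∈ Set.Ioo (0:ℝ) 1 :=
    ae_restrict_mem measurableSet_Ioo
  have hlim : ∀ᵐ t ∂(volume.restrict (Set.Ioo (0:ℝ) 1)), ∃ l : Fin m → ℝ,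
      Tendsto (fun k => lsq (A t) (deriv γ t) k) atTop (𝓝 l) ∧
      A t *ᵥ l = deriv γ t ∧ ∀ i, |l i| < (m + 1) * δ := by
    filter_upwards [hd, hd'] with t ht htI
    have e : deriv γ t = A t *ᵥ (fun i => c i t) := by rw [ht.deriv, hsum]
    obtain ⟨c1, h1, h2, h3⟩ := lsq_limit (A t) (fun i => c i t)
    refine ⟨c1, by rw [e]; exact h1, by rw [e]; exact h2, fun i => ?_⟩
    have k1 : c1 i ^ 2 ≤ c1 ⬝ᵥ c1 := by
      rw [sq]
      exact Finset.single_le_sum (f := fun j => c1 j * c1 j) (fun j _ => mul_self_nonneg _) (Finset.mem_univ i)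
    have k2 : (fun i => c i t) ⬝ᵥ (fun i => c i t) ≤ m * δ ^ 2 := by
      have : ∀ i ∈ (Finset.univ : Finset (Fin m)), c i t * c i t ≤ δ ^ 2 := by
        intro i _
        have := hc i t (Set.Ioo_subset_Icc_self htI)
        rw [← abs_mul_abs_self, ← sq]
        exact pow_le_pow_left₀ (abs_nonneg _) this.le 2
      have := Finset.sum_le_card_nsmul _ _ _ this
      simpa [dotProduct] using this
    apply abs_lt_of_sq_lt_sq _ (by positivity)
    have hm : (0:ℝ) ≤ m := Nat.cast_nonneg m
    have hδ2 : 0 < δ ^ 2 := by positivity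
    nlinarith [mul_nonneg hm hδ2.le, mul_nonneg (mul_nonneg hm hm) hδ2.le]
  obtain ⟨f, hf, hft⟩ := measurable_limit_of_tendsto_metrizable_ae
    (f := fun k t => lsq (A t) (deriv γ t) k) (L := atTop)
    (fun k => (measurable_lsq hA hv k).aemeasurable) (hlim.mono fun t ⟨l, h, _⟩ => ⟨l, h⟩)
  have hfi : ∀ i, Measurable fun t => f t i := fun i => (measurable_pi_apply i).comp hf
  classical
  refine ⟨fun i t => if |f t i| < (m + 1) * δ then f t i else 0, ?_, ?_, ?_⟩
  · intro i
    refine Measurable.ite ?_ (hfi i) measurable_const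
    exact measurableSet_lt (hfi i).abs measurable_const
  · intro i t
    dsimp only
    split_ifs with h
    · exact h
    · simp; positivity
  · filter_upwards [hlim, hft, hd] with t ⟨l, hl, hAl, hb⟩ h2 h3
    have e : f t = l := tendsto_nhds_unique h2 hl
    have : ∑ i, (if |f t i| < (m + 1) * δ then f t i else 0) • X i (γ t) = deriv γ t := by
      rw [← hAl, hsum, e]
      exact Finset.sum_congr rfl fun i _ => by rw [if_pos (hb i)]
    rw [this]
    exact h3.differentiableAt.hasDerivAt

end Lift

namespace LiftedSetting

open Filter Topology

variable {n p m : ℕ} (S : LiftedSetting n p m)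

/-- The group data of the lifted space. -/
def grp : GrpData ((Fin n → ℝ) × (Fin p → ℝ)) where
  mul := S.mul
  inv := S.inv
  sm := S.smooth_mul
  si := S.smooth_inv
  assoc := S.mul_assoc'
  zero_mul := S.zero_mul'
  mul_zero := S.mul_zero'
  inv_mul := S.inv_mul'
  mul_inv := S.mul_inv'

theorem lineDeriv_clm {F : Type*} [NormedAddCommGroup F] [NormedSpace ℝ F]
    (φ : F →L[ℝ] ℝ) (x v : F) : lineDeriv ℝ (fun w => φ w) x v = φ v :=
  (φ.hasFDerivAt.hasLineDerivAt v).lineDeriv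

theorem Xt_LI (i : Fin m) : S.grp.LI (S.Xt i) := by
  intro z x
  have key : ∀ φ : ((Fin n → ℝ) × (Fin p → ℝ)) →L[ℝ] ℝ,
      φ (S.grp.D (z, x) (0, S.Xt i x)) = φ (S.Xt i (S.grp.mul z x)) := by
    intro φ
    have h := S.lift_leftinv i z (fun w => φ w) φ.contDiff x
    have h1 : HasFDerivAt (fun w => φ (S.grp.mul z w)) _ x :=
      φ.hasFDerivAt.comp x (S.grp.hasDL z x)
    have h2 := (h1.hasLineDerivAt (S.Xt i x)).lineDeriv
    unfold vfDeriv at h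
    rw [lineDeriv_clm] at h
    change lineDeriv ℝ (fun w => φ (S.grp.mul z w)) x (S.Xt i x) = _ at h
    rw [h2] at h
    exact h
  refine Prod.ext (funext fun k => ?_) (funext fun k => ?_)
  · exact key ((ContinuousLinearMap.proj k).comp (ContinuousLinearMap.fst ℝ _ _))
  · exact key ((ContinuousLinearMap.proj k).comp (ContinuousLinearMap.snd ℝ _ _))

theorem reach_all (a b : (Fin n → ℝ) × (Fin p → ℝ)) : Reach S.Xt a b :=
  S.grp.chow S.lift_smooth S.Xt_LI S.hormanderLift a b

theorem R_homog (i : Fin m) (j : Fin p) {l : ℝ} (hl : 0 < l) (q : (Fin n → ℝ) × (Fin p → ℝ)) :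
    l ^ S.τ j * S.R i q j = l * S.R i (dil S.σ l q.1, dil S.τ l q.2) j := by
  let φ : ((Fin n → ℝ) × (Fin p → ℝ)) →L[ℝ] ℝ :=
    (ContinuousLinearMap.proj j).comp (ContinuousLinearMap.snd ℝ _ _)
  have h := S.lift_homog i (fun w => φ w) φ.contDiff l hl q
  unfold vfDeriv at h
  rw [lineDeriv_clm] at h
  have e : (fun w : (Fin n → ℝ) × (Fin p → ℝ) => φ (dil S.σ l w.1, dil S.τ l w.2)) =
      fun w => (l ^ S.τ j • φ) w := by
    funext w; simp [φ, dil]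
  rw [e, lineDeriv_clm] at h
  simpa [φ] using h

theorem R_contDiff (i : Fin m) : ContDiff ℝ (⊤ : ℕ∞) (S.R i) :=
  contDiff_snd.comp (S.lift_smooth i)

theorem dil_tendsto {N : ℕ} (σ : Fin N → ℕ) (hσ : ∀ i, 1 ≤ σ i) (x : Fin N → ℝ) :
    Tendsto (fun l : ℝ => dil σ l x) (𝓝 0) (𝓝 0) := by
  have hc : Continuous (fun l : ℝ => dil σ l x) := by
    unfold dil; fun_prop
  have h0 : dil σ 0 x = 0 := by
    funext i
    have : σ i ≠ 0 := by have := hσ i; omega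
    simp [dil, this]
  simpa [h0] using hc.tendsto 0

theorem R_triangular (i : Fin m) (j : Fin p) (x : Fin n → ℝ) (ξ ξ' : Fin p → ℝ)
    (h : ∀ l, S.τ l < S.τ j → ξ l = ξ' l) : S.R i (x, ξ) j = S.R i (x, ξ') j := by
  obtain ⟨K, U, hU, hK⟩ := ((S.R_contDiff i).contDiffAt (x := 0)).of_le (m := 1) (by simp)
    |>.exists_lipschitzOnWith
  have t1 : ∀ ζ : Fin p → ℝ, ∀ᶠ l in 𝓝[>] (0:ℝ), (dil S.σ l x, dil S.τ l ζ) ∈ U := by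
    intro ζ
    have := (dil_tendsto S.σ S.σ_ge_one x).prodMk_nhds (dil_tendsto S.τ S.τ_ge_one ζ)
    exact (this.mono_left nhdsWithin_le_nhds).eventually hU
  have hle : ∀ᶠ l in 𝓝[>] (0:ℝ), |S.R i (x, ξ) j - S.R i (x, ξ') j| ≤ l * (K * ‖ξ - ξ'‖) := by
    have hlt : ∀ᶠ l in 𝓝[>] (0:ℝ), l < 1 :=
      (gt_mem_nhds (zero_lt_one)).filter_mono nhdsWithin_le_nhds
    filter_upwards [t1 ξ, t1 ξ', self_mem_nhdsWithin, hlt] with l h1 h2 (hl : 0 < l) hl1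
    have hd := hK.dist_le_mul _ h1 _ h2
    have hd1 : dist ((dil S.σ l x, dil S.τ l ξ) : (Fin n → ℝ) × (Fin p → ℝ))
        (dil S.σ l x, dil S.τ l ξ') ≤ l ^ S.τ j * ‖ξ - ξ'‖ := by
      rw [Prod.dist_eq]
      refine max_le (by simp; positivity) ?_
      rw [dist_pi_le_iff (by positivity)]
      intro k
      simp only [dil]
      rw [Real.dist_eq, ← mul_sub, abs_mul, abs_of_pos (by positivity)]
      by_cases hk : S.τ k < S.τ j
      · rw [h k hk]; simp; positivity
      · refine mul_le_mul ?_ (norm_le_pi_norm (ξ - ξ') k) (abs_nonneg _) (by positivity)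
        exact pow_le_pow_of_le_one hl.le hl1.le (not_lt.1 hk)
    have hd2 := (dist_le_pi_dist _ _ j).trans (hd.trans (mul_le_mul_of_nonneg_left hd1 K.2))
    rw [Real.dist_eq] at hd2
    have e1 := S.R_homog i j hl (x, ξ)
    have e2 := S.R_homog i j hl (x, ξ')
    simp only at e1 e2
    have hp : 0 < l ^ S.τ j := by positivity
    have e3 : l ^ S.τ j * |S.R i (x, ξ) j - S.R i (x, ξ') j| =
        l * |S.R i (dil S.σ l x, dil S.τ l ξ) j - S.R i (dil S.σ l x, dil S.τ l ξ') j| := by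
      rw [← abs_of_pos hp, ← abs_mul, mul_sub, e1, e2, ← mul_sub, abs_mul,
        abs_of_pos hl]
    have e4 : l ^ S.τ j * |S.R i (x, ξ) j - S.R i (x, ξ') j| ≤ 
        l ^ S.τ j * (l * (K * ‖ξ - ξ'‖)) := by
      rw [e3]
      refine (mul_le_mul_of_nonneg_left hd2 hl.le).trans (le_of_eq ?_)
      change l * ((K:ℝ) * _) = _
      ring
    exact le_of_mul_le_mul_left e4 hp
  have ht : Tendsto (fun l : ℝ => l * ((K:ℝ) * ‖ξ - ξ'‖)) (𝓝[>] 0) (𝓝 0) := by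
    have hc : Continuous (fun l : ℝ => l * ((K:ℝ) * ‖ξ - ξ'‖)) := by fun_prop
    have := hc.tendsto 0
    rw [zero_mul] at this
    exact this.mono_left nhdsWithin_le_nhds
  have := ge_of_tendsto ht hle
  exact sub_eq_zero.1 (abs_eq_zero.1 (le_antisymm this (abs_nonneg _)))

/-- Integrand of the lifted equation. -/
def rhs (γ : ℝ → Fin n → ℝ) (b : Fin m → ℝ → ℝ) (ξ : ℝ → Fin p → ℝ) (j : Fin p) (s : ℝ) : ℝ :=
  ∑ i, b i s * S.R i (γ s, ξ s) j

/-- Picard operator. -/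
def picardOp (γ : ℝ → Fin n → ℝ) (b : Fin m → ℝ → ℝ) (ξ : ℝ → Fin p → ℝ) : ℝ → Fin p → ℝ :=
  fun t j => ∫ s in (0:ℝ)..t, S.rhs γ b ξ j s

section

variable {γ : ℝ → Fin n → ℝ} {b : Fin m → ℝ → ℝ} {C : ℝ} {ξ : ℝ → Fin p → ℝ}

theorem R_cont (hγ : Continuous γ) (hξ : Continuous ξ) (i : Fin m) (j : Fin p) :
    Continuous fun s => S.R i (γ s, ξ s) j :=
  (continuous_apply j).comp ((S.R_contDiff i).continuous.comp (hγ.prodMk hξ))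

theorem rhs_bound (hC : ∀ i t, |b i t| < C) (j : Fin p) (s : ℝ) :
    |S.rhs γ b ξ j s| ≤ ∑ i, C * |S.R i (γ s, ξ s) j| := by
  refine (Finset.abs_sum_le_sum_abs _ _).trans (Finset.sum_le_sum fun i _ => ?_)
  rw [abs_mul]
  exact mul_le_mul_of_nonneg_right (hC i s).le (abs_nonneg _)

theorem bound_cont (hγ : Continuous γ) (hξ : Continuous ξ) (j : Fin p) :
    Continuous fun s => ∑ i, C * |S.R i (γ s, ξ s) j| :=
  continuous_finset_sum _ fun i _ => (S.R_cont hγ hξ i j).abs.const_mul C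

theorem rhs_locInt (hγ : Continuous γ) (hξ : Continuous ξ) (hb : ∀ i, Measurable (b i))
    (hC : ∀ i t, |b i t| < C) (j : Fin p) : LocallyIntegrable (S.rhs γ b ξ j) volume := by
  refine (S.bound_cont (C := C) hγ hξ j).locallyIntegrable.mono ?_ ?_
  · have : Measurable (S.rhs γ b ξ j) := by
      unfold rhs
      exact Finset.measurable_sum _ fun i _ => (hb i).mul (S.R_cont hγ hξ i j).measurable
    exact this.aestronglyMeasurable
  · refine Eventually.of_forall fun s => ?_
    rw [Real.norm_eq_abs, Real.norm_eq_abs]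
    exact (S.rhs_bound hC j s).trans (le_abs_self _)

theorem rhs_int (hγ : Continuous γ) (hξ : Continuous ξ) (hb : ∀ i, Measurable (b i))
    (hC : ∀ i t, |b i t| < C) (j : Fin p) (x y : ℝ) :
    IntervalIntegrable (S.rhs γ b ξ j) volume x y :=
  intervalIntegrable_iff.mpr <|
    ((S.rhs_locInt hγ hξ hb hC j).integrableOn_isCompact isCompact_uIcc).mono_set
      Set.uIoc_subset_uIcc

theorem picard_cont (hγ : Continuous γ) (hξ : Continuous ξ) (hb : ∀ i, Measurable (b i))
    (hC : ∀ i t, |b i t| < C) : Continuous (S.picardOp γ b ξ) :=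
  continuous_pi fun j => intervalIntegral.continuous_primitive (S.rhs_int hγ hξ hb hC j) 0

theorem exists_fixed (hγ : Continuous γ) (hb : ∀ i, Measurable (b i))
    (hC : ∀ i t, |b i t| < C) : ∃ ξ : ℝ → Fin p → ℝ, Continuous ξ ∧ S.picardOp γ b ξ = ξ := by
  have hcont : ∀ k, Continuous ((S.picardOp γ b)^[k] 0) := by
    intro k
    induction k with
    | zero => exact continuous_zero
    | succ k ih => rw [Function.iterate_succ_apply']; exact S.picard_cont hγ ih hb hC
  have stab : ∀ k, ∀ j, S.τ j ≤ k → ∀ t,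
      (S.picardOp γ b)^[k+1] 0 t j = (S.picardOp γ b)^[k] 0 t j := by
    intro k
    induction k with
    | zero => intro j hj; have := S.τ_ge_one j; omega
    | succ k ih =>
      intro j hj t
      rw [Function.iterate_succ_apply' _ (k+1), Function.iterate_succ_apply' _ k]
      change ∫ s in (0:ℝ)..t, _ = ∫ s in (0:ℝ)..t, _
      congr 1
      funext s
      unfold rhs
      refine Finset.sum_congr rfl fun i _ => ?_
      rw [S.R_triangular i j (γ s) _ (((S.picardOp γ b)^[k] 0) s)]
      intro l hl
      rw [← Function.iterate_succ_apply' (S.picardOp γ b) k 0]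
      exact ih l (by omega) s
  refine ⟨(S.picardOp γ b)^[Finset.univ.sup S.τ] 0, hcont _, ?_⟩
  funext t j
  rw [← Function.iterate_succ_apply' (S.picardOp γ b)]
  exact stab _ j (Finset.le_sup (Finset.mem_univ j)) t

end

theorem lift_mem {x y : Fin n → ℝ} {δ : ℝ}
    (h : δ ∈ {δ : ℝ | 0 < δ ∧ ∃ γ : ℝ → (Fin n → ℝ), ∃ c : Fin m → ℝ → ℝ, ∃ K : NNReal,
    LipschitzOnWith K γ (Set.Icc 0 1) ∧ γ 0 = x ∧ γ 1 = y ∧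
    (∀ᵐ t ∂(volume.restrict (Set.Ioo (0:ℝ) 1)),
      HasDerivAt γ (∑ i, c i t • S.X i (γ t)) t) ∧
    (∀ i, ∀ t ∈ Set.Icc (0:ℝ) 1, |c i t| < δ)}) :
    ∃ η : Fin p → ℝ, S.dXt (x, 0) (y, η) ≤ (m + 1) * δ := by
  obtain ⟨hδ, γ0, c, K, hL, hx, hy, hd, hc⟩ := h
  let γ : ℝ → Fin n → ℝ := fun t => γ0 (Set.projIcc (0:ℝ) 1 zero_le_one t)
  have hγ : Continuous γ := hL.continuousOn.comp_continuous
    (continuous_subtype_val.comp continuous_projIcc) (fun t => Subtype.coe_prop _)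
  have eγ : ∀ t ∈ Set.Icc (0:ℝ) 1, γ t = γ0 t := by
    intro t ht
    simp only [γ]
    rw [Set.projIcc_of_mem zero_le_one ht]
  have hdγ : ∀ᵐ t ∂(volume.restrict (Set.Ioo (0:ℝ) 1)),
      HasDerivAt γ (∑ i, c i t • S.X i (γ t)) t := by
    filter_upwards [hd, ae_restrict_mem measurableSet_Ioo] with t ht htI
    rw [eγ t (Set.Ioo_subset_Icc_self htI)]
    refine ht.congr_of_eventuallyEq ?_
    filter_upwards [isOpen_Ioo.mem_nhds htI] with s hs
    exact eγ s (Set.Ioo_subset_Icc_self hs)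
  obtain ⟨b, hb, hbC, hdb⟩ := exists_measurable_controls S.X (fun i => (S.X_smooth i).continuous)
    γ hγ c hδ hdγ hc
  obtain ⟨ξ, hξ, hfix⟩ := S.exists_fixed hγ hb hbC
  have hξe : ∀ t j, ξ t j = ∫ s in (0:ℝ)..t, S.rhs γ b ξ j s := by
    intro t j
    conv_lhs => rw [← hfix]
    rfl
  refine ⟨ξ 1, csInf_le ⟨0, fun _ h => h.1.le⟩ ?_⟩
  obtain ⟨M, hM⟩ := isCompact_Icc.exists_bound_of_continuousOn (s := Set.Icc (0:ℝ) 1)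
    (continuous_pi fun j => S.bound_cont (C := (m + 1) * δ) hγ hξ j).continuousOn
  have hM0 : 0 ≤ M := (norm_nonneg _).trans (hM 0 (by simp))
  have hLγ : LipschitzOnWith K γ (Set.Icc 0 1) := by
    intro s hs t ht
    rw [eγ s hs, eγ t ht]; exact hL hs ht
  have hLξ : LipschitzOnWith M.toNNReal ξ (Set.Icc 0 1) := by
    refine LipschitzOnWith.of_dist_le_mul fun s hs t ht => ?_
    rw [Real.coe_toNNReal _ hM0, dist_pi_le_iff (by positivity)]
    intro j
    rw [Real.dist_eq, hξe, hξe, intervalIntegral.integral_interval_sub_left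
      (S.rhs_int hγ hξ hb hbC j _ _) (S.rhs_int hγ hξ hb hbC j _ _), Real.dist_eq]
    rw [← Real.norm_eq_abs]
    refine intervalIntegral.norm_integral_le_of_norm_le_const (f := S.rhs γ b ξ j) (a := t) (b := s)
      (C := M) fun r hr => ?_
    have hr' : r ∈ Set.Icc (0:ℝ) 1 :=
      Set.uIcc_subset_Icc ht hs (Set.uIoc_subset_uIcc hr)
    refine (S.rhs_bound hbC j r).trans ?_
    exact (le_abs_self _).trans ((norm_le_pi_norm _ j).trans (hM r hr'))
  refine ⟨by positivity, fun t => (γ t, ξ t), b, max K M.toNNReal, hLγ.prodMk hLξ, ?_, ?_, ?_, ?_⟩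
  · refine Prod.ext ?_ ?_
    · simp only; rw [eγ 0 (by simp), hx]
    · funext j; simp [hξe]
  · refine Prod.ext ?_ rfl
    simp only; rw [eγ 1 (by simp), hy]
  · have hj : ∀ᵐ t ∂(volume.restrict (Set.Ioo (0:ℝ) 1)), ∀ j,
        HasDerivAt (fun x => ∫ s in (0:ℝ)..x, S.rhs γ b ξ j s) (S.rhs γ b ξ j t) t := by
      rw [ae_all_iff]
      intro j
      refine ae_restrict_of_ae ?_
      filter_upwards [LocallyIntegrable.ae_hasDerivAt_integral (S.rhs_locInt hγ hξ hb hbC j)] with t ht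
      exact ht 0
    filter_upwards [hdb, hj] with t h1 h2
    have h3 : HasDerivAt ξ (∑ i, b i t • S.R i (γ t, ξ t)) t := by
      rw [hasDerivAt_pi]
      intro j
      have e : (fun x => ξ x j) = fun x => ∫ s in (0:ℝ)..x, S.rhs γ b ξ j s := by
        funext x; exact hξe x j
      rw [e]
      have e2 : (∑ i, b i t • S.R i (γ t, ξ t)) j = S.rhs γ b ξ j t := by
        simp [rhs, Finset.sum_apply]
      rw [e2]
      exact h2 j
    have e : (∑ i, b i t • S.Xt i (γ t, ξ t)) =
        (∑ i, b i t • S.X i (γ t), ∑ i, b i t • S.R i (γ t, ξ t)) := by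
      refine Prod.ext ?_ ?_
      · rw [Prod.fst_sum]; rfl
      · rw [Prod.snd_sum]; rfl
    exact (h1.prodMk h3).congr_deriv e.symm
  · intro i t _; exact hbC i t

theorem dX_nonneg (x y : Fin n → ℝ) : 0 ≤ S.dX x y := Real.sInf_nonneg fun _ h => h.1.le

theorem dX_le (a b : (Fin n → ℝ) × (Fin p → ℝ)) : S.dX a.1 b.1 ≤ S.dXt a b := by
  refine csInf_le_csInf ⟨0, fun _ h => h.1.le⟩ (S.reach_all a b) ?_
  rintro δ ⟨hδ, γ, c, K, hL, hx, hy, hd, hc⟩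
  refine ⟨hδ, fun t => (γ t).1, c, 1 * K, LipschitzWith.prod_fst.comp_lipschitzOnWith hL,
    by simp [hx], by simp [hy], ?_, hc⟩
  filter_upwards [hd] with t ht
  have := (hasFDerivAt_fst (𝕜 := ℝ) (p := γ t)).comp_hasDerivAt t ht
  have e : (∑ i, c i t • S.X i (γ t).1) = (∑ i, c i t • S.Xt i (γ t)).1 := by
    rw [Prod.fst_sum]; rfl
  exact this.congr_deriv e.symm

theorem holder_up {α : ℝ} (hα : 0 < α) {f : (Fin n → ℝ) → ℝ} {C : ℝ} (hC : 0 ≤ C)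
    (h : holderBoundOn S.dX α Set.univ f C) :
    holderBoundOn S.dXt α Set.univ (fun q : (Fin n → ℝ) × (Fin p → ℝ) => f q.1) C := by
  intro a _ b _
  refine (h a.1 trivial b.1 trivial).trans (mul_le_mul_of_nonneg_left ?_ hC)
  exact Real.rpow_le_rpow (S.dX_nonneg _ _) (S.dX_le a b) hα.le

theorem holder_down {α : ℝ} (hα : 0 < α) {f : (Fin n → ℝ) → ℝ} {C : ℝ} (hC : 0 ≤ C)
    (h : holderBoundOn S.dXt α Set.univ (fun q : (Fin n → ℝ) × (Fin p → ℝ) => f q.1) C) :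
    holderBoundOn S.dX α Set.univ f (((m:ℝ) + 1) ^ α * C) := by
  intro x _ y _
  have hne : Reach S.X x y := by
    obtain ⟨δ, hδ, γ, c, K, hL, hx, hy, hd, hc⟩ := S.reach_all (x, 0) (y, 0)
    refine ⟨δ, hδ, fun t => (γ t).1, c, 1 * K, LipschitzWith.prod_fst.comp_lipschitzOnWith hL,
      by simp [hx], by simp [hy], ?_, hc⟩
    filter_upwards [hd] with t ht
    have := (hasFDerivAt_fst (𝕜 := ℝ) (p := γ t)).comp_hasDerivAt t ht
    have e : (∑ i, c i t • S.X i (γ t).1) = (∑ i, c i t • S.Xt i (γ t)).1 := by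
      rw [Prod.fst_sum]; rfl
    exact this.congr_deriv e.symm
  have hδ : ∀ e > 0, |f x - f y| ≤ C * ((m + 1) * (S.dX x y + e)) ^ α := by
    intro e he
    obtain ⟨δ, hδm, hδlt⟩ := Real.lt_sInf_add_pos hne he
    obtain ⟨η, hη⟩ := S.lift_mem hδm
    refine (h (x, 0) trivial (y, η) trivial).trans (mul_le_mul_of_nonneg_left ?_ hC)
    have h0 : 0 ≤ S.dXt (x, 0) (y, η) := Real.sInf_nonneg fun _ h => h.1.le
    refine Real.rpow_le_rpow h0 (hη.trans ?_) hα.le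
    exact mul_le_mul_of_nonneg_left hδlt.le (by positivity)
  have ht : Tendsto (fun e : ℝ => C * ((m + 1) * (S.dX x y + e)) ^ α) (𝓝[>] 0)
      (𝓝 (C * ((m + 1) * (S.dX x y + 0)) ^ α)) := by
    have hc : Continuous (fun e : ℝ => C * ((m + 1) * (S.dX x y + e)) ^ α) := by
      refine continuous_const.mul (Continuous.rpow_const (by fun_prop) fun _ => Or.inr hα.le)
    exact (hc.tendsto 0).mono_left nhdsWithin_le_nhds
  have := ge_of_tendsto ht (by filter_upwards [self_mem_nhdsWithin] with e he using hδ e he)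
  rw [add_zero, Real.mul_rpow (by positivity) (S.dX_nonneg _ _)] at this
  linarith

theorem semi_up {α : ℝ} (hα : 0 < α) (f : (Fin n → ℝ) → ℝ) :
    holderSemi S.dXt α Set.univ (fun q : (Fin n → ℝ) × (Fin p → ℝ) => f q.1) ≤
      holderSemi S.dX α Set.univ f := by
  by_cases hne : {C : ℝ | 0 ≤ C ∧ holderBoundOn S.dX α Set.univ f C}.Nonempty
  · exact csInf_le_csInf ⟨0, fun _ h => h.1⟩ hne fun C hC => ⟨hC.1, S.holder_up hα hC.1 hC.2⟩
  · have : {C : ℝ | 0 ≤ C ∧ holderBoundOn S.dXt α Set.univ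
        (fun q : (Fin n → ℝ) × (Fin p → ℝ) => f q.1) C} = ∅ := by
      rw [Set.eq_empty_iff_forall_notMem]
      rintro C ⟨hC0, hC⟩
      have h1 : (0:ℝ) ≤ ((m:ℝ) + 1) ^ α := by positivity
      exact hne ⟨_, mul_nonneg h1 hC0, S.holder_down hα hC0 hC⟩
    unfold holderSemi
    rw [this, Real.sInf_empty]
    exact Real.sInf_nonneg fun _ h => h.1

theorem semi_down {α : ℝ} (hα : 0 < α) (f : (Fin n → ℝ) → ℝ) :
    holderSemi S.dX α Set.univ f ≤ ((m:ℝ) + 1) ^ α *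
      holderSemi S.dXt α Set.univ (fun q : (Fin n → ℝ) × (Fin p → ℝ) => f q.1) := by
  have hm : (0:ℝ) < ((m:ℝ) + 1) ^ α := by positivity
  by_cases hne : {C : ℝ | 0 ≤ C ∧ holderBoundOn S.dXt α Set.univ
        (fun q : (Fin n → ℝ) × (Fin p → ℝ) => f q.1) C}.Nonempty
  · rw [← div_le_iff₀' hm]
    refine le_csInf hne ?_
    rintro C ⟨hC0, hC⟩
    rw [div_le_iff₀' hm]
    exact csInf_le ⟨0, fun _ h => h.1⟩ ⟨mul_nonneg hm.le hC0, S.holder_down hα hC0 hC⟩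
  · have : {C : ℝ | 0 ≤ C ∧ holderBoundOn S.dX α Set.univ f C} = ∅ := by
      rw [Set.eq_empty_iff_forall_notMem]
      rintro C ⟨hC0, hC⟩
      exact hne ⟨C, hC0, S.holder_up hα hC0 hC⟩
    unfold holderSemi
    rw [this, Real.sInf_empty]
    exact mul_nonneg hm.le (Real.sInf_nonneg fun _ h => h.1)

theorem sup_eq (f : (Fin n → ℝ) → ℝ) :
    supNormOn Set.univ (fun q : (Fin n → ℝ) × (Fin p → ℝ) => f q.1) = supNormOn Set.univ f := by
  unfold supNormOn
  congr 1
  ext C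
  constructor
  · rintro ⟨h0, h⟩; exact ⟨h0, fun x _ => h (x, 0) trivial⟩
  · rintro ⟨h0, h⟩; exact ⟨h0, fun x _ => h x.1 trivial⟩

theorem vfIter_ext (f : (Fin n → ℝ) → ℝ) (l : List (Fin m)) :
    vfIter S.Xt l (fun q : (Fin n → ℝ) × (Fin p → ℝ) => f q.1) = fun q => vfIter S.X l f q.1 := by
  induction l with
  | nil => rfl
  | cons i l ih =>
    simp only [vfIter]
    rw [ih]
    rfl

end LiftedSetting

/-- **Extension estimates for the lifted operator** (Lemma 5.3). -/
theorem extension_estimates_lifted_operator {n p m : ℕ} (hp : 0 < p)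
    (S : LiftedSetting n p m)
    (Λ α : ℝ) (hΛ : Λ ∈ Set.Ioo (0:ℝ) 1) (hα : α ∈ Set.Ioo (0:ℝ) 1)
    (k : ℕ)
    (a : Fin m → Fin m → (Fin n → ℝ) → ℝ)
    (ha_ell : EllipticSym a Λ)
    (ha_reg : ∀ i j, MemCkAlpha S.X S.dX α k Set.univ (a i j)) :
    ∃ c > (0:ℝ), ∀ u : (Fin n → ℝ) → ℝ,
      MemCkAlpha S.X S.dX α (k + 2) Set.univ u →
      MemCkAlpha S.Xt S.dXt α (k + 2) Set.univ (fun q => u q.1) ∧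
      ckNorm S.X S.dX α (k + 2) Set.univ u ≤
        c * ckNorm S.Xt S.dXt α (k + 2) Set.univ (fun q => u q.1) ∧
      ckNorm S.Xt S.dXt α k Set.univ
          (opL S.Xt (fun i j q => a i j q.1) (fun q => u q.1)) ≤
        ckNorm S.X S.dX α k Set.univ (opL S.X a u) := by
  have hα0 := hα.1
  have hm : (1:ℝ) ≤ ((m:ℝ) + 1) ^ α := by
    refine Real.one_le_rpow ?_ hα0.le
    have : (0:ℝ) ≤ m := Nat.cast_nonneg m
    linarith
  refine ⟨((m:ℝ) + 1) ^ α, by linarith, fun u hu => ⟨⟨?_, ?_⟩, ?_, ?_⟩⟩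
  · intro l hl
    rw [S.vfIter_ext]
    obtain ⟨⟨C, hC0, hC⟩, ⟨C', hC0', hC'⟩⟩ := hu.1 l hl
    exact ⟨⟨C, hC0, fun x _ => hC x.1 trivial⟩, ⟨C', hC0', S.holder_up hα0 hC0' hC'⟩⟩
  · intro l hl i q _
    rw [S.vfIter_ext]
    exact hu.2 l hl i q.1 trivial
  · unfold ckNorm
    rw [Finset.mul_sum]
    refine Finset.sum_le_sum fun j _ => ?_
    rw [Finset.mul_sum]
    refine Finset.sum_le_sum fun f _ => ?_
    rw [S.vfIter_ext]
    unfold holderNorm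
    rw [mul_add, LiftedSetting.sup_eq]
    refine add_le_add ?_ (S.semi_down hα0 _)
    exact le_mul_of_one_le_left (Real.sInf_nonneg fun _ h => h.1) hm
  · have e : opL S.Xt (fun i j q => a i j q.1) (fun q => u q.1) =
        fun q : (Fin n → ℝ) × (Fin p → ℝ) => opL S.X a u q.1 := by
      funext q
      unfold opL
      simp only [S.vfIter_ext]
    rw [e]
    unfold ckNorm
    refine Finset.sum_le_sum fun j _ => Finset.sum_le_sum fun f _ => ?_
    rw [S.vfIter_ext]
    unfold holderNorm
    rw [LiftedSetting.sup_eq]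
    exact add_le_add le_rfl (S.semi_up hα0 _)

end
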